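/- Let M be a lattice, G a group acting on M by isometries, and S_G = (M^G)^⊥ the coinvariant sublattice. Assume S_G contains no element v with b(v, v) = −2, and let α ∈ M satisfy b(α, α) = −2. Then α does not lie in the ℚ-span of S_G, and the primitive closure S = [S_G ∪ G·α]_pr = [S_G ∪ {α}]_pr has rank rk S = rk S_G + 1. -/

import Mathlib

/-- The invariant sublattice `M^G` of a `G`-action. -/
def invariantSublattice {M G : Type*} [AddCommGroup M] [Group G]
    (ρ : G →* M ≃ₗ[ℤ] M) : Submodule ℤ M where
  carrier := {x | ∀ g : G, ρ g x = x}
  add_mem' := fun ha hb g => by rw [map_add, ha g, hb g]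
  zero_mem' := fun g => map_zero _
  smul_mem' := fun c x hx g => by rw [map_smul, hx g]

/-- The coinvariant sublattice `S_G = (M^G)^⊥`. -/
def coinvariantSublattice {M G : Type*} [AddCommGroup M] [Group G]
    (b : M →ₗ[ℤ] M →ₗ[ℤ] ℤ) (ρ : G →* M ≃ₗ[ℤ] M) : Submodule ℤ M where
  carrier := {y | ∀ x ∈ invariantSublattice ρ, b y x = 0}
  add_mem' := fun ha hc x hx => by
    rw [map_add, LinearMap.add_apply, ha x hx, hc x hx, add_zero]
  zero_mem' := fun x _ => by rw [map_zero, LinearMap.zero_apply]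
  smul_mem' := fun n y hy x hx => by
    rw [map_smul, LinearMap.smul_apply, hy x hx, smul_zero]

/-- The primitive closure `[A]_pr` of a subset `A ⊆ M`: all `m ∈ M` such that `n • m`
lies in the subgroup of `M` generated by `A` for some positive integer `n`. -/
def primClosure {M : Type*} [AddCommGroup M] (A : Set M) : Submodule ℤ M where
  carrier := {m | ∃ n : ℤ, 0 < n ∧ n • m ∈ Submodule.span ℤ A}
  zero_mem' := ⟨1, one_pos, by simp⟩
  add_mem' := by
    rintro a c ⟨n, hn, ha⟩ ⟨k, hk, hc⟩
    refine ⟨n * k, mul_pos hn hk, ?_⟩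
    have h : (n * k) • (a + c) = k • (n • a) + n • (k • c) := by
      rw [smul_add, smul_smul, smul_smul, mul_comm k n]
    rw [h]
    exact Submodule.add_mem _ (Submodule.smul_mem _ _ ha) (Submodule.smul_mem _ _ hc)
  smul_mem' := by
    intro c m hm
    obtain ⟨n, hn, h⟩ := hm
    refine ⟨n, hn, ?_⟩
    have hcomm : n • c • m = c • n • m := by rw [smul_smul, smul_smul, mul_comm]
    rw [hcomm]
    exact Submodule.smul_mem _ _ h

/-- Taking the primitive closure does not change the rank. -/
theorem finrank_primClosure {M : Type*} [AddCommGroup M] [Module.Finite ℤ M] (A : Set M) :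
    Module.finrank ℤ ↥(primClosure A) = Module.finrank ℤ ↥(Submodule.span ℤ A) := by
  have hle : Submodule.span ℤ A ≤ primClosure A := fun m hm => ⟨1, one_pos, by rwa [one_smul]⟩
  have heq := (Submodule.submoduleOfEquivOfLe hle).finrank_eq
  refine le_antisymm ?_ (Submodule.finrank_mono hle)
  by_contra! hlt
  rw [← heq] at hlt
  obtain ⟨⟨m, n, hn, hm⟩, h⟩ := Submodule.exists_of_finrank_lt _ hlt
  exact h n hn.ne' hm

/-- Adjoining a vector that is independent of a submodule raises the rank by one. -/
theorem finrank_sup_span_singleton {M : Type*} [AddCommGroup M] [Module.Free ℤ M]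
    [Module.Finite ℤ M] (N : Submodule ℤ M) {x : M} (hx : ∀ n : ℤ, n ≠ 0 → n • x ∉ N) :
    Module.finrank ℤ ↥(N ⊔ Submodule.span ℤ {x}) = Module.finrank ℤ N + 1 := by
  have hx0 : x ≠ 0 := by
    rintro rfl
    exact hx 1 one_ne_zero (by simp)
  have hinf : N ⊓ Submodule.span ℤ {x} = ⊥ := by
    refine (Submodule.eq_bot_iff _).2 ?_
    rintro y ⟨hyN, hy⟩
    obtain ⟨n, rfl⟩ := Submodule.mem_span_singleton.1 hy
    by_cases hn : n = 0
    · rw [hn, zero_smul]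
    · exact absurd hyN (hx n hn)
  have hspan : Module.finrank ℤ ↥(Submodule.span ℤ {x}) = 1 := by
    rw [← (LinearEquiv.toSpanNonzeroSingleton ℤ M x hx0).finrank_eq, Module.finrank_self]
  have h := Submodule.rank_sup_add_rank_inf_eq N (Submodule.span ℤ {x})
  rw [hinf, rank_bot, add_zero] at h
  simp only [← Module.finrank_eq_rank] at h
  rw [← hspan]
  exact_mod_cast h

/-- The coinvariant sublattice is primitive. -/
theorem mem_coinvariantSublattice_of_smul_mem {M G : Type*} [AddCommGroup M] [Group G]
    {b : M →ₗ[ℤ] M →ₗ[ℤ] ℤ} {ρ : G →* M ≃ₗ[ℤ] M} {n : ℤ} (hn : n ≠ 0) {y : M}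
    (hy : n • y ∈ coinvariantSublattice b ρ) : y ∈ coinvariantSublattice b ρ := by
  intro x hx
  have h := hy x hx
  rw [map_smul, LinearMap.smul_apply, smul_eq_mul] at h
  exact (mul_eq_zero.1 h).resolve_left hn

theorem map_sub_self_mem_coinvariantSublattice {M G : Type*} [AddCommGroup M] [Group G]
    {b : M →ₗ[ℤ] M →ₗ[ℤ] ℤ} {ρ : G →* M ≃ₗ[ℤ] M}
    (hiso : ∀ (g : G) (x y : M), b (ρ g x) (ρ g y) = b x y) (g : G) (y : M) :
    ρ g y - y ∈ coinvariantSublattice b ρ := by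
  intro x hx
  have h := hiso g y x
  rw [hx g] at h
  rw [map_sub, LinearMap.sub_apply, h, sub_self]

theorem span_coinvariantSublattice_union_orbit {M G : Type*} [AddCommGroup M] [Group G]
    {b : M →ₗ[ℤ] M →ₗ[ℤ] ℤ} {ρ : G →* M ≃ₗ[ℤ] M}
    (hiso : ∀ (g : G) (x y : M), b (ρ g x) (ρ g y) = b x y) (y : M) :
    Submodule.span ℤ ((coinvariantSublattice b ρ : Set M) ∪ Set.range fun g : G => ρ g y) =
      coinvariantSublattice b ρ ⊔ Submodule.span ℤ {y} := by
  rw [Submodule.span_union, Submodule.span_eq]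
  refine le_antisymm (sup_le le_sup_left (Submodule.span_le.2 ?_))
    (sup_le_sup_left (Submodule.span_mono ?_) _)
  · rintro _ ⟨g, rfl⟩
    rw [SetLike.mem_coe]
    exact Submodule.mem_sup.2 ⟨_, map_sub_self_mem_coinvariantSublattice hiso g y, y,
      Submodule.mem_span_singleton_self y, sub_add_cancel _ _⟩
  · rintro _ rfl
    exact ⟨1, by simp⟩

/-- If the coinvariant sublattice `S_G = (M^G)^⊥` contains no vector of
square `-2` and `α ∈ M` has `b α α = -2`, then `α` does not lie in the `ℚ`-span of `S_G`
(i.e. no positive multiple of `α` lies in `S_G`'s span), and the primitive closure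
`S = [S_G ∪ G·α]_pr = [S_G ∪ {α}]_pr` has rank `rk S_G + 1`. -/
theorem rank_primClosure_coinvariant_add_orbit
    {M G : Type*} [AddCommGroup M] [Module.Free ℤ M] [Module.Finite ℤ M] [Group G]
    (b : M →ₗ[ℤ] M →ₗ[ℤ] ℤ) (hsymm : ∀ x y : M, b x y = b y x)
    (ρ : G →* M ≃ₗ[ℤ] M) (hiso : ∀ (g : G) (x y : M), b (ρ g x) (ρ g y) = b x y)
    (hroot : ∀ v ∈ coinvariantSublattice b ρ, b v v ≠ -2)
    (α : M) (hα : b α α = -2) :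
    (¬ ∃ n : ℤ, 0 < n ∧ n • α ∈ Submodule.span ℤ (coinvariantSublattice b ρ : Set M)) ∧
    primClosure ((coinvariantSublattice b ρ : Set M) ∪ Set.range fun g : G => ρ g α) =
      primClosure ((coinvariantSublattice b ρ : Set M) ∪ {α}) ∧
    Module.finrank ℤ
        ↥(primClosure ((coinvariantSublattice b ρ : Set M) ∪ Set.range fun g : G => ρ g α)) =
      Module.finrank ℤ ↥(coinvariantSublattice b ρ) + 1 := by
  have hmem (n : ℤ) (hn : n ≠ 0) : n • α ∉ coinvariantSublattice b ρ := fun h =>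
    hroot α (mem_coinvariantSublattice_of_smul_mem hn h) hα
  have hspan := span_coinvariantSublattice_union_orbit hiso α
  refine ⟨?_, ?_, ?_⟩
  · rintro ⟨n, hn, h⟩
    rw [Submodule.span_eq] at h
    exact hmem n hn.ne' h
  · ext m
    change (∃ n : ℤ, 0 < n ∧ _ ∈ Submodule.span ℤ _) ↔ ∃ n : ℤ, 0 < n ∧ _ ∈ Submodule.span ℤ _
    rw [hspan, Submodule.span_union _ {α}, Submodule.span_eq]
  · rw [finrank_primClosure, hspan, finrank_sup_span_singleton _ hmem]
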